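/- arXiv:math/0202072 — 3 statements merged into one kernel-verified Lean document; each statement's English description precedes it below -/
import Mathlib

section
/- Fix an integer k ≥ 0 and two pairs of integers (ℓ, m) ≠ (ℓ′, m′), each satisfying |ℓ| + |m| ≤ k, ℓ + m ≡ k (mod 2) (respectively |ℓ′| + |m′| ≤ k, ℓ′ + m′ ≡ k (mod 2)). Then ∫_{χ=0}^{π/2} ∫_{θ=0}^{2π} ∫_{φ=0}^{2π} Ψ̃_{kℓm}(χ,θ,φ) · Ψ̃_{kℓ′m′}(χ,θ,φ) · cos χ · sin χ dφ dθ dχ = 0. -/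
noncomputable section


/-- `circ j u v` is `A_j(u,v)`: the real part of `(u + iv)^|j|` if `j ≥ 0`,
and the imaginary part if `j < 0`. -/
def circ (j : ℤ) (u v : ℝ) : ℝ :=
  if 0 ≤ j then (((u : ℂ) + v * Complex.I) ^ j.natAbs).re
  else (((u : ℂ) + v * Complex.I) ^ j.natAbs).im

/-- `dd k ℓ m = (k - |ℓ| - |m|) / 2`. -/
def dd (k : ℕ) (ℓ m : ℤ) : ℕ := (k - ℓ.natAbs - m.natAbs) / 2

/-- The function `F_{kℓm} : ℝ⁴ → ℝ`. -/
def F (k : ℕ) (ℓ m : ℤ) (p : Fin 4 → ℝ) : ℝ :=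
  (∑ i ∈ Finset.range (dd k ℓ m + 1),
      (Nat.choose (m.natAbs + dd k ℓ m) i : ℝ) *
      (Nat.choose (ℓ.natAbs + dd k ℓ m) (dd k ℓ m - i) : ℝ) *
      (p 0 ^ 2 + p 1 ^ 2) ^ i * (-(p 2 ^ 2 + p 3 ^ 2)) ^ (dd k ℓ m - i))
    * circ ℓ (p 0) (p 1) * circ m (p 2) (p 3)

/-- `f` is the evaluation of a homogeneous polynomial of degree `k`. -/
def IsHomogeneousPolyEval (k : ℕ) (f : (Fin 4 → ℝ) → ℝ) : Prop :=
  ∃ P : MvPolynomial (Fin 4) ℝ, P.IsHomogeneous k ∧ ∀ v, MvPolynomial.eval v P = f v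

/-- `f` is harmonic: the sum of its four second coordinate partial derivatives vanishes. -/
def IsHarmonic (f : (Fin 4 → ℝ) → ℝ) : Prop :=
  ∀ v : Fin 4 → ℝ,
    ∑ i : Fin 4, fderiv ℝ (fun w => fderiv ℝ f w (Pi.single i 1)) v (Pi.single i 1) = 0

/-- The Jacobi polynomial `P_d^{(a,b)}`. -/
def jacobiP (d a b : ℕ) (u : ℝ) : ℝ :=
  (1 / 2 ^ d) * ∑ i ∈ Finset.range (d + 1),
    (Nat.choose (a + d) i : ℝ) * (Nat.choose (b + d) (d - i) : ℝ) *
      (u + 1) ^ i * (u - 1) ^ (d - i)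

/-- The radial function `X_{kℓm}`. -/
def Xrad (k : ℕ) (ℓ m : ℤ) (χ : ℝ) : ℝ :=
  Real.cos χ ^ ℓ.natAbs * Real.sin χ ^ m.natAbs *
    jacobiP (dd k ℓ m) m.natAbs ℓ.natAbs (Real.cos (2 * χ))

/-- The circular harmonic: `cos(|j|·θ)` if `j ≥ 0`, else `sin(|j|·θ)`. -/
def circHarm (j : ℤ) (θ : ℝ) : ℝ :=
  if 0 ≤ j then Real.cos (j.natAbs * θ) else Real.sin (j.natAbs * θ)

/-- The eigenmode `Ψ̃_{kℓm}` in toroidal coordinates. -/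
def PsiT (k : ℕ) (ℓ m : ℤ) (χ θ φ : ℝ) : ℝ :=
  Xrad k ℓ m χ * circHarm ℓ θ * circHarm m φ

/-- The rotation `R(Δθ, Δφ)` of `ℝ⁴`. -/
def Rrot (a b : ℝ) (p : Fin 4 → ℝ) : Fin 4 → ℝ :=
  ![p 0 * Real.cos a - p 1 * Real.sin a,
    p 0 * Real.sin a + p 1 * Real.cos a,
    p 2 * Real.cos b - p 3 * Real.sin b,
    p 2 * Real.sin b + p 3 * Real.cos b]

/-- The isometry `A(x,y,z,w) = (z, -w, -x, y)`. -/
def Amap (p : Fin 4 → ℝ) : Fin 4 → ℝ :=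
  ![p 2, -(p 3), -(p 0), p 1]

/-- The sign `σ_{kℓm}`. -/
def sgn (k : ℕ) (ℓ m : ℤ) : ℝ :=
  (if Even (dd k ℓ m) then 1 else -1) * (if 0 ≤ ℓ then 1 else -1) *
  (if 0 ≤ m then 1 else -1) * (if Even m then 1 else -1)

theorem integral_cos_intCast_mul (n : ℤ) (hn : n ≠ 0) :
    ∫ θ in (0:ℝ)..(2 * Real.pi), Real.cos (n * θ) = 0 := by
  have hn' : (n : ℝ) ≠ 0 := Int.cast_ne_zero.mpr hn
  rw [intervalIntegral.integral_comp_mul_left (fun x => Real.cos x) hn', integral_cos,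
    mul_zero, Real.sin_zero]
  have h := Real.sin_int_mul_pi (n * 2)
  push_cast at h
  rw [← mul_assoc, h]
  simp

theorem integral_sin_intCast_mul (n : ℤ) :
    ∫ θ in (0:ℝ)..(2 * Real.pi), Real.sin (n * θ) = 0 := by
  rcases eq_or_ne n 0 with rfl | hn
  · simp
  have hn' : (n : ℝ) ≠ 0 := Int.cast_ne_zero.mpr hn
  rw [intervalIntegral.integral_comp_mul_left (fun x => Real.sin x) hn', integral_sin,
    mul_zero, Real.cos_zero, Real.cos_int_mul_two_pi]
  simp

theorem integral_cos_mul_cos_natCast (a b : ℕ) (h : a ≠ b) :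
    ∫ θ in (0:ℝ)..(2 * Real.pi), Real.cos (a * θ) * Real.cos (b * θ) = 0 := by
  have e (θ : ℝ) : Real.cos (a * θ) * Real.cos (b * θ) =
      (Real.cos (((a - b : ℤ) : ℝ) * θ) + Real.cos (((a + b : ℤ) : ℝ) * θ)) / 2 := by
    push_cast
    rw [sub_mul, add_mul, Real.cos_sub, Real.cos_add]
    ring
  simp only [e]
  rw [intervalIntegral.integral_div, intervalIntegral.integral_add
    (Continuous.intervalIntegrable (by fun_prop) _ _)
    (Continuous.intervalIntegrable (by fun_prop) _ _),
    integral_cos_intCast_mul _ (by omega), integral_cos_intCast_mul _ (by omega)]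
  simp

theorem integral_sin_mul_sin_natCast (a b : ℕ) (h : a ≠ b) :
    ∫ θ in (0:ℝ)..(2 * Real.pi), Real.sin (a * θ) * Real.sin (b * θ) = 0 := by
  have e (θ : ℝ) : Real.sin (a * θ) * Real.sin (b * θ) =
      (Real.cos (((a - b : ℤ) : ℝ) * θ) - Real.cos (((a + b : ℤ) : ℝ) * θ)) / 2 := by
    push_cast
    rw [sub_mul, add_mul, Real.cos_sub, Real.cos_add]
    ring
  simp only [e]
  rw [intervalIntegral.integral_div, intervalIntegral.integral_sub
    (Continuous.intervalIntegrable (by fun_prop) _ _)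
    (Continuous.intervalIntegrable (by fun_prop) _ _),
    integral_cos_intCast_mul _ (by omega), integral_cos_intCast_mul _ (by omega)]
  simp

theorem integral_sin_mul_cos_natCast (a b : ℕ) :
    ∫ θ in (0:ℝ)..(2 * Real.pi), Real.sin (a * θ) * Real.cos (b * θ) = 0 := by
  have e (θ : ℝ) : Real.sin (a * θ) * Real.cos (b * θ) =
      (Real.sin (((a - b : ℤ) : ℝ) * θ) + Real.sin (((a + b : ℤ) : ℝ) * θ)) / 2 := by
    push_cast
    rw [sub_mul, add_mul, Real.sin_sub, Real.sin_add]
    ring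
  simp only [e]
  rw [intervalIntegral.integral_div, intervalIntegral.integral_add
    (Continuous.intervalIntegrable (by fun_prop) _ _)
    (Continuous.intervalIntegrable (by fun_prop) _ _),
    integral_sin_intCast_mul, integral_sin_intCast_mul]
  simp

/-- Distinct circular harmonics are orthogonal on the circle. -/
theorem integral_circHarm_mul_circHarm (i j : ℤ) (h : i ≠ j) :
    ∫ θ in (0:ℝ)..(2 * Real.pi), circHarm i θ * circHarm j θ = 0 := by
  unfold circHarm
  split_ifs
  · exact integral_cos_mul_cos_natCast _ _ (by omega)
  · simpa only [mul_comm (Real.cos _)] using integral_sin_mul_cos_natCast j.natAbs i.natAbs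
  · exact integral_sin_mul_cos_natCast _ _
  · exact integral_sin_mul_sin_natCast _ _ (by omega)

/-- distinct eigenmodes `Ψ̃_{kℓm}`, `Ψ̃_{kℓ'm'}` are orthogonal. -/
theorem stmt_3 (k : ℕ) (ℓ m ℓ' m' : ℤ)
    (h1 : ℓ.natAbs + m.natAbs ≤ k) (h2 : Int.ModEq 2 (ℓ + m) k)
    (h1' : ℓ'.natAbs + m'.natAbs ≤ k) (h2' : Int.ModEq 2 (ℓ' + m') k)
    (hne : (ℓ, m) ≠ (ℓ', m')) :
    ∫ χ in (0:ℝ)..(Real.pi / 2), ∫ θ in (0:ℝ)..(2 * Real.pi),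
      ∫ φ in (0:ℝ)..(2 * Real.pi),
        PsiT k ℓ m χ θ φ * PsiT k ℓ' m' χ θ φ * Real.cos χ * Real.sin χ = 0 := by
  have e (χ θ φ : ℝ) : PsiT k ℓ m χ θ φ * PsiT k ℓ' m' χ θ φ * Real.cos χ * Real.sin χ =
      (Xrad k ℓ m χ * Xrad k ℓ' m' χ * Real.cos χ * Real.sin χ) *
        ((circHarm ℓ θ * circHarm ℓ' θ) * (circHarm m φ * circHarm m' φ)) := by
    unfold PsiT
    ring
  simp only [e, intervalIntegral.integral_const_mul, intervalIntegral.integral_mul_const]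
  by_cases hl : ℓ = ℓ'
  · have hm : m ≠ m' := fun hm => hne (by rw [hl, hm])
    simp [integral_circHarm_mul_circHarm m m' hm]
  · simp [integral_circHarm_mul_circHarm ℓ ℓ' hl]

end
end

section
/- For all integers k ≥ 0 and ℓ, m with |ℓ| + |m| ≤ k and ℓ + m ≡ k (mod 2), with d = (k − |ℓ| − |m|)/2: ∫_{χ=0}^{π/2} ∫_{θ=0}^{2π} ∫_{φ=0}^{2π} Ψ̃_{kℓm}(χ,θ,φ)² · cos χ · sin χ dφ dθ dχ = 2^{ℓ̂+m̂} · π² · (|ℓ|+d)! · (|m|+d)! / (2·(k+1)·d!·(|ℓ|+|m|+d)!), where ℓ̂ = 1 if ℓ = 0 and ℓ̂ = 0 otherwise, and m̂ = 1 if m = 0 and m̂ = 0 otherwise. -/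
noncomputable section


open Polynomial in
/-- Integration by parts for polynomials on `[0, 1]` without boundary terms. -/
theorem integral_eval_iterate_derivative_mul (n : ℕ) (p q : ℝ[X])
    (h0 : ∀ j < n, (derivative^[j] p).eval 0 = 0) (h1 : ∀ j < n, (derivative^[j] p).eval 1 = 0) :
    ∫ x in (0 : ℝ)..1, (derivative^[n] p).eval x * q.eval x =
      (-1) ^ n * ∫ x in (0 : ℝ)..1, p.eval x * (derivative^[n] q).eval x := by
  induction n generalizing q with
  | zero => simp
  | succ n ih =>
    have hparts := intervalIntegral.integral_mul_deriv_eq_deriv_mul (a := 0) (b := 1)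
      (fun x _ => q.hasDerivAt x) (fun x _ => (derivative^[n] p).hasDerivAt x)
      ((derivative q).continuous.intervalIntegrable _ _)
      ((derivative (derivative^[n] p)).continuous.intervalIntegrable _ _)
    rw [h0 n n.lt_succ_self, h1 n n.lt_succ_self] at hparts
    have hn := ih (derivative q) (fun j hj => h0 j (hj.trans n.lt_succ_self))
      (fun j hj => h1 j (hj.trans n.lt_succ_self))
    simp only [mul_comm (eval _ (derivative q))] at hparts
    rw [Function.iterate_succ_apply', Function.iterate_succ_apply, pow_succ]
    simp only [mul_comm _ (eval _ q)]
    rw [hparts, hn]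
    ring

theorem integral_pow_mul_one_sub_pow (p q : ℕ) :
    ∫ x in (0 : ℝ)..1, x ^ p * (1 - x) ^ q =
      (p.factorial * q.factorial : ℝ) / (p + q + 1).factorial := by
  induction q generalizing p with
  | zero =>
    simp only [pow_zero, mul_one, integral_pow, Nat.factorial_zero, add_zero, Nat.factorial_succ]
    have := Nat.factorial_ne_zero p
    push_cast
    field_simp
    simp
  | succ q ih =>
    have hparts := intervalIntegral.integral_mul_deriv_eq_deriv_mul (a := (0 : ℝ)) (b := 1)
      (u := fun x : ℝ => (1 - x) ^ (q + 1)) (u' := fun x => -((q + 1 : ℝ) * (1 - x) ^ q))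
      (v := fun x : ℝ => x ^ (p + 1)) (v' := fun x => (p + 1 : ℝ) * x ^ p)
      (fun x _ => by
        simpa using ((hasDerivAt_id x).const_sub 1).fun_pow (q + 1))
      (fun x _ => by simpa using hasDerivAt_pow (p + 1) x)
      (Continuous.intervalIntegrable (by fun_prop) _ _)
      (Continuous.intervalIntegrable (by fun_prop) _ _)
    have hl : ∀ x : ℝ, (1 - x) ^ (q + 1) * ((p + 1 : ℝ) * x ^ p) =
        (p + 1) * (x ^ p * (1 - x) ^ (q + 1)) := fun x => by ring
    have hr : ∀ x : ℝ, -((q + 1 : ℝ) * (1 - x) ^ q) * x ^ (p + 1) =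
        -(q + 1) * (x ^ (p + 1) * (1 - x) ^ q) := fun x => by ring
    simp only [hl, hr, intervalIntegral.integral_const_mul, ih] at hparts
    have hp : (p + 1 : ℝ) ≠ 0 := by positivity
    refine mul_left_cancel₀ hp (hparts.trans ?_)
    rw [show p + 1 + q + 1 = p + (q + 1) + 1 by ring, Nat.factorial_succ p, Nat.factorial_succ q]
    push_cast
    simp
    ring

open Polynomial in
/-- The polynomial `t ↦ P_d^{(a,b)}(2t - 1)`. -/
def shiftedJacobi (d a b : ℕ) : ℝ[X] :=
  ∑ i ∈ Finset.range (d + 1), C (((a + d).choose i : ℝ) * (b + d).choose (d - i)) *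
    (X ^ i * (X - C 1) ^ (d - i))

theorem jacobiP_eq_eval_shiftedJacobi (d a b : ℕ) (t : ℝ) :
    jacobiP d a b (2 * t - 1) = (shiftedJacobi d a b).eval t := by
  simp only [jacobiP, shiftedJacobi, Polynomial.eval_finsetSum, Finset.mul_sum]
  refine Finset.sum_congr rfl fun i hi => ?_
  have hid : i + (d - i) = d := by grind
  rw [show 2 * t - 1 + 1 = 2 * t by ring, show 2 * t - 1 - 1 = 2 * (t - 1) by ring,
    mul_pow, mul_pow]
  have h2 : (2 : ℝ) ^ d = 2 ^ i * 2 ^ (d - i) := by rw [← pow_add, hid]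
  rw [h2]
  simp
  field_simp

open Polynomial in
/-- Rodrigues' formula. -/
theorem iterate_derivative_eq_factorial_smul_shiftedJacobi (d a b : ℕ) :
    derivative^[d] (X ^ (b + d) * (X - C 1) ^ (a + d) : ℝ[X]) =
      C (d.factorial : ℝ) * (X ^ b * (X - C 1) ^ a * shiftedJacobi d a b) := by
  rw [iterate_derivative_mul, shiftedJacobi, Finset.mul_sum, Finset.mul_sum]
  refine Finset.sum_congr rfl fun i hi => ?_
  have hid : i ≤ d := by grind
  rw [iterate_derivative_X_pow_eq_C_mul, iterate_derivative_X_sub_pow,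
    Nat.descFactorial_eq_factorial_mul_choose, Nat.descFactorial_eq_factorial_mul_choose,
    ← Nat.choose_mul_factorial_mul_factorial hid, show b + d - (d - i) = b + i by lia,
    show a + d - i = a + (d - i) by lia]
  simp only [nsmul_eq_mul, pow_add, map_mul, Nat.cast_mul, map_natCast]
  ring

open Polynomial in
theorem natDegree_shiftedJacobi_le (d a b : ℕ) : (shiftedJacobi d a b).natDegree ≤ d := by
  refine natDegree_sum_le_of_forall_le _ _ fun i hi => ?_
  refine (natDegree_C_mul_le _ _).trans (natDegree_mul_le.trans ?_)
  rw [natDegree_X_pow, natDegree_pow, natDegree_X_sub_C]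
  grind

open Polynomial in
theorem coeff_shiftedJacobi (d a b : ℕ) :
    (shiftedJacobi d a b).coeff d = (a + b + 2 * d).choose d := by
  rw [show a + b + 2 * d = (a + d) + (b + d) by ring, Nat.add_choose_eq,
    Finset.Nat.sum_antidiagonal_eq_sum_range_succ_mk, shiftedJacobi, finsetSum_coeff]
  push_cast
  refine Finset.sum_congr rfl fun i hi => ?_
  have hid : i + (d - i) = d := by grind
  have hmonic : (X ^ i * (X - C 1) ^ (d - i) : ℝ[X]).Monic :=
    (monic_X_pow i).mul ((monic_X_sub_C 1).pow _)
  have hdeg : (X ^ i * (X - C 1) ^ (d - i) : ℝ[X]).natDegree = d := by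
    rw [(monic_X_pow i).natDegree_mul ((monic_X_sub_C 1).pow _), natDegree_X_pow, natDegree_pow,
      natDegree_X_sub_C, mul_one, hid]
  have hc := hmonic.coeff_natDegree
  rw [hdeg] at hc
  rw [coeff_C_mul, hc, mul_one]

open Polynomial in
theorem iterate_derivative_eq_C_of_natDegree_le {R : Type*} [CommSemiring R] {d : ℕ} {p : R[X]}
    (hp : p.natDegree ≤ d) : derivative^[d] p = C (d.factorial * p.coeff d) := by
  ext n
  rw [coeff_iterate_derivative]
  rcases n with - | n
  · simp [Nat.descFactorial_self]
  · rw [coeff_eq_zero_of_natDegree_lt (by lia), coeff_C_succ, smul_zero]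

open Polynomial in
theorem eval_iterate_derivative_eq_zero_of_pow_dvd {R : Type*} [CommRing R] {n j : ℕ} {p : R[X]}
    {c : R} (hp : (X - C c) ^ n ∣ p) (hj : j < n) : (derivative^[j] p).eval c = 0 :=
  dvd_iff_isRoot.1 ((dvd_pow_self _ (Nat.sub_ne_zero_of_lt hj)).trans
    (pow_sub_dvd_iterate_derivative_of_pow_dvd j hp))

open Polynomial in
theorem integral_weight_mul_shiftedJacobi_sq (d a b : ℕ) :
    ∫ t in (0 : ℝ)..1, t ^ b * (1 - t) ^ a * (shiftedJacobi d a b).eval t ^ 2 =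
      ((b + d).factorial * (a + d).factorial : ℝ) /
        ((a + b + 2 * d + 1) * d.factorial * (b + a + d).factorial) := by
  set Q := shiftedJacobi d a b with hQ
  have hparts := integral_eval_iterate_derivative_mul d
    (X ^ (b + d) * (X - C 1) ^ (a + d) : ℝ[X]) Q
    (fun j hj => eval_iterate_derivative_eq_zero_of_pow_dvd (n := b + d)
      (by simp) (by lia))
    (fun j hj => eval_iterate_derivative_eq_zero_of_pow_dvd (n := a + d)
      (dvd_mul_left _ _) (by lia))
  rw [iterate_derivative_eq_factorial_smul_shiftedJacobi,
    iterate_derivative_eq_C_of_natDegree_le (natDegree_shiftedJacobi_le d a b),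
    coeff_shiftedJacobi] at hparts
  have hl : ∀ x : ℝ, (C (d.factorial : ℝ) * (X ^ b * (X - C 1) ^ a * Q)).eval x * Q.eval x =
      (-1) ^ a * d.factorial * (x ^ b * (1 - x) ^ a * Q.eval x ^ 2) := fun x => by
    simp only [eval_mul, eval_C, eval_pow, eval_X, eval_sub]
    rw [show x - 1 = (-1) * (1 - x) by ring, mul_pow]
    ring
  have hr : ∀ x : ℝ, (X ^ (b + d) * (X - C 1) ^ (a + d) : ℝ[X]).eval x *
      (C (d.factorial * (a + b + 2 * d).choose d : ℝ)).eval x =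
      (-1) ^ (a + d) * (d.factorial * (a + b + 2 * d).choose d) *
        (x ^ (b + d) * (1 - x) ^ (a + d)) := fun x => by
    simp only [eval_mul, eval_C, eval_pow, eval_X, eval_sub]
    rw [show x - 1 = (-1) * (1 - x) by ring, mul_pow]
    ring
  simp only [← hQ, hl, hr, intervalIntegral.integral_const_mul,
    integral_pow_mul_one_sub_pow] at hparts
  have hchoose : ((a + b + 2 * d).choose d : ℝ) * d.factorial * (b + a + d).factorial =
      (a + b + 2 * d).factorial := by
    rw [show b + a + d = a + b + 2 * d - d by lia]
    exact_mod_cast Nat.choose_mul_factorial_mul_factorial (by lia)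
  rw [show b + d + (a + d) + 1 = a + b + 2 * d + 1 by ring, Nat.factorial_succ] at hparts
  push_cast at hparts
  rw [← hchoose] at hparts
  have hc : ((a + b + 2 * d).choose d : ℝ) ≠ 0 := by
    exact_mod_cast (Nat.choose_pos (by lia)).ne'
  have hd : (d.factorial : ℝ) ≠ 0 := by positivity
  have hs : ((-1 : ℝ)) ^ d * (-1) ^ d = 1 := by rw [← mul_pow]; simp
  have ha : ((-1 : ℝ)) ^ a ≠ 0 := by simp
  refine mul_left_cancel₀ (mul_ne_zero ha hd) (hparts.trans ?_)
  rw [pow_add]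
  field_simp
  linear_combination hs

theorem integral_Xrad_sq (k : ℕ) (ℓ m : ℤ) :
    ∫ χ in (0 : ℝ)..(Real.pi / 2), Xrad k ℓ m χ ^ 2 * Real.cos χ * Real.sin χ =
      ((ℓ.natAbs + dd k ℓ m).factorial * (m.natAbs + dd k ℓ m).factorial : ℝ) /
        (2 * (ℓ.natAbs + m.natAbs + 2 * dd k ℓ m + 1) * (dd k ℓ m).factorial *
          (ℓ.natAbs + m.natAbs + dd k ℓ m).factorial) := by
  set Q := shiftedJacobi (dd k ℓ m) m.natAbs ℓ.natAbs with hQ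
  have hsubst := intervalIntegral.integral_comp_mul_deriv (a := 0) (b := Real.pi / 2)
    (f := fun x => Real.cos x ^ 2) (f' := fun x => 2 * Real.cos x * -Real.sin x)
    (g := fun t => t ^ ℓ.natAbs * (1 - t) ^ m.natAbs * Q.eval t ^ 2)
    (fun x _ => by simpa using (Real.hasDerivAt_cos x).fun_pow 2)
    (Continuous.continuousOn (by fun_prop))
    (by fun_prop)
  have hint : ∀ x : ℝ, Xrad k ℓ m x ^ 2 * Real.cos x * Real.sin x = (-1 / 2) *
      (((fun t => t ^ ℓ.natAbs * (1 - t) ^ m.natAbs * Q.eval t ^ 2) ∘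
        fun x => Real.cos x ^ 2) x * (2 * Real.cos x * -Real.sin x)) := fun x => by
    simp only [Xrad, Function.comp_apply, Real.cos_two_mul, jacobiP_eq_eval_shiftedJacobi, ← hQ]
    rw [← Real.sin_sq]
    ring
  simp only [hint, intervalIntegral.integral_const_mul]
  rw [hsubst]
  simp only [Real.cos_pi_div_two, Real.cos_zero, one_pow, ne_eq, OfNat.ofNat_ne_zero,
    not_false_eq_true, zero_pow]
  rw [intervalIntegral.integral_symm, hQ, integral_weight_mul_shiftedJacobi_sq]
  have : (m.natAbs + ℓ.natAbs + 2 * dd k ℓ m + 1 : ℝ) ≠ 0 := by positivity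
  field_simp
  ring

theorem integral_circHarm_sq (j : ℤ) :
    ∫ θ in (0 : ℝ)..(2 * Real.pi), circHarm j θ ^ 2 =
      2 ^ (if j = 0 then 1 else 0) * Real.pi := by
  rcases eq_or_ne j 0 with rfl | hj
  · simp [circHarm]
  have hn : (j.natAbs : ℝ) ≠ 0 := by exact_mod_cast Int.natAbs_ne_zero.2 hj
  have hsin : Real.sin (j.natAbs * (2 * Real.pi)) = 0 := by
    simpa using Real.sin_periodic.nat_mul_eq j.natAbs
  unfold circHarm
  split_ifs
  · rw [intervalIntegral.integral_comp_mul_left (fun x => Real.cos x ^ 2) hn, integral_cos_sq,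
      hsin]
    simp
    field_simp
  · rw [intervalIntegral.integral_comp_mul_left (fun x => Real.sin x ^ 2) hn, integral_sin_sq,
      hsin]
    simp
    field_simp

/-- the squared norm of the eigenmode `Ψ̃_{kℓm}`. -/
theorem stmt_4 (k : ℕ) (ℓ m : ℤ) (h1 : ℓ.natAbs + m.natAbs ≤ k)
    (h2 : Int.ModEq 2 (ℓ + m) k) :
    ∫ χ in (0:ℝ)..(Real.pi / 2), ∫ θ in (0:ℝ)..(2 * Real.pi),
      ∫ φ in (0:ℝ)..(2 * Real.pi),
        PsiT k ℓ m χ θ φ ^ 2 * Real.cos χ * Real.sin χ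
    = 2 ^ (((if ℓ = 0 then 1 else 0) + (if m = 0 then 1 else 0) : ℕ)) * Real.pi ^ 2 *
        ((Nat.factorial (ℓ.natAbs + dd k ℓ m) : ℝ) *
          (Nat.factorial (m.natAbs + dd k ℓ m) : ℝ)) /
        (2 * ((k : ℝ) + 1) * (Nat.factorial (dd k ℓ m) : ℝ) *
          (Nat.factorial (ℓ.natAbs + m.natAbs + dd k ℓ m) : ℝ)) := by
  have hk : (ℓ.natAbs + m.natAbs + 2 * dd k ℓ m + 1 : ℝ) = k + 1 := by
    have : ℓ.natAbs + m.natAbs + 2 * dd k ℓ m = k := by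
      unfold dd
      unfold Int.ModEq at h2
      lia
    exact_mod_cast congrArg (· + 1) this
  have hint : ∀ χ θ φ : ℝ, PsiT k ℓ m χ θ φ ^ 2 * Real.cos χ * Real.sin χ =
      Xrad k ℓ m χ ^ 2 * Real.cos χ * Real.sin χ * circHarm ℓ θ ^ 2 * circHarm m φ ^ 2 :=
    fun χ θ φ => by unfold PsiT; ring
  simp only [hint, intervalIntegral.integral_const_mul, intervalIntegral.integral_mul_const,
    integral_circHarm_sq, integral_Xrad_sq, hk]
  rw [pow_add]
  ring

end
end

section
/- Fix an integer k ≥ 0. Every function f : ℝ⁴ → ℝ that is the evaluation of a homogeneous polynomial of degree k in the four coordinates and is harmonic (∂²f/∂x² + ∂²f/∂y² + ∂²f/∂z² + ∂²f/∂w² = 0 identically) is a real linear combination of the functions F_{kℓm}, taken over all pairs of integers (ℓ, m) with |ℓ| + |m| ≤ k and ℓ + m ≡ k (mod 2). -/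
noncomputable section


open MvPolynomial in
theorem hasFDerivAt_eval {σ : Type*} [Fintype σ] (P : MvPolynomial σ ℝ) (v : σ → ℝ) :
    HasFDerivAt (fun w : σ → ℝ => eval w P)
      (∑ j, eval v (pderiv j P) • ContinuousLinearMap.proj (R := ℝ) (φ := fun _ : σ => ℝ) j) v := by
  classical
  induction P using MvPolynomial.induction_on with
  | C a => simpa using hasFDerivAt_const a v
  | add p q hp hq =>
    simp only [map_add, add_smul, Finset.sum_add_distrib]
    exact hp.add hq
  | mul_X p i hp =>
    simp only [map_mul, eval_X]
    refine (hp.mul (hasFDerivAt_apply i v)).congr_fderiv ?_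
    ext w
    simp [Derivation.leibniz, pderiv_X, Pi.single_apply, add_mul, Finset.sum_add_distrib,
      Finset.mul_sum, apply_ite, mul_assoc]

open MvPolynomial in
theorem fderiv_eval_single {σ : Type*} [Fintype σ] [DecidableEq σ] (P : MvPolynomial σ ℝ) (i : σ)
    (v : σ → ℝ) :
    fderiv ℝ (fun w : σ → ℝ => eval w P) v (Pi.single i 1) = eval v (pderiv i P) := by
  simp [(hasFDerivAt_eval P v).fderiv, Pi.single_apply]

open MvPolynomial in
/-- A polynomial whose evaluation is harmonic has vanishing formal Laplacian. -/
theorem sum_pderiv_pderiv_eq_zero {P : MvPolynomial (Fin 4) ℝ}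
    (h : IsHarmonic fun v => eval v P) : ∑ i, pderiv i (pderiv i P) = 0 := by
  refine MvPolynomial.funext fun v => ?_
  have := h v
  simp only [fderiv_eval_single] at this
  simpa using this

open MvPolynomial in
/-- The chain rule for substitution into a polynomial. -/
theorem pderiv_aeval {R S σ τ : Type*} [CommSemiring R] [CommSemiring S] [Algebra R S]
    [Fintype σ] (g : σ → MvPolynomial τ S) (P : MvPolynomial σ R) (i : τ) :
    pderiv i (aeval g P) = ∑ j, aeval g (pderiv j P) * pderiv i (g j) := by
  classical
  induction P using MvPolynomial.induction_on with
  | C a => simp [algebraMap_eq, IsScalarTower.algebraMap_apply R S (MvPolynomial τ S)]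
  | add p q hp hq => simp [hp, hq, add_mul, Finset.sum_add_distrib]
  | mul_X p k hp =>
    simp [Derivation.leibniz, pderiv_X, Pi.single_apply, add_mul, Finset.sum_add_distrib,
      Finset.mul_sum, apply_ite, mul_assoc, hp]

open MvPolynomial in
theorem pderiv_comm {R σ : Type*} [CommSemiring R] (P : MvPolynomial σ R) (i j : σ) :
    pderiv i (pderiv j P) = pderiv j (pderiv i P) := by
  classical
  ext s
  rcases eq_or_ne i j with rfl | h
  · rfl
  · simp [coeff_pderiv, h, h.symm, add_right_comm s, mul_right_comm]

open MvPolynomial in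
/-- The real coordinates of `ℝ⁴ = ℂ²` as linear forms in `u, ū, v, v̄`. -/
def complexSubst : Fin 4 → MvPolynomial (Fin 4) ℂ :=
  ![C (1 / 2) * (X 0 + X 1), C (-Complex.I / 2) * (X 0 - X 1),
    C (1 / 2) * (X 2 + X 3), C (-Complex.I / 2) * (X 2 - X 3)]

/-- The complex coordinates `u, ū, v, v̄` of a point of `ℝ⁴ = ℂ²`. -/
def complexCoords (p : Fin 4 → ℝ) : Fin 4 → ℂ :=
  ![p 0 + p 1 * Complex.I, p 0 - p 1 * Complex.I, p 2 + p 3 * Complex.I, p 2 - p 3 * Complex.I]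

open MvPolynomial in
theorem isHomogeneous_complexSubst (i : Fin 4) : (complexSubst i).IsHomogeneous 1 := by
  have h (a : ℂ) (s t : Fin 4) : (C a * (X s + X t)).IsHomogeneous 1 := by
    exact (isHomogeneous_C (Fin 4) a).mul ((isHomogeneous_X ℂ s).add (isHomogeneous_X ℂ t))
  have h' (a : ℂ) (s t : Fin 4) : (C a * (X s - X t)).IsHomogeneous 1 := by
    exact (isHomogeneous_C (Fin 4) a).mul ((isHomogeneous_X ℂ s).sub (isHomogeneous_X ℂ t))
  fin_cases i
  exacts [h .., h' .., h .., h' ..]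

open MvPolynomial in
theorem eval_aeval_complexSubst (P : MvPolynomial (Fin 4) ℝ) (p : Fin 4 → ℝ) :
    eval (complexCoords p) (aeval complexSubst P) = (eval p P : ℂ) := by
  induction P using MvPolynomial.induction_on with
  | C a => simp [algebraMap_eq, IsScalarTower.algebraMap_apply ℝ ℂ (MvPolynomial (Fin 4) ℂ)]
  | add p q hp hq => simp [hp, hq]
  | mul_X q k hq =>
    have h : eval (complexCoords p) (complexSubst k) = (p k : ℂ) := by
      have := Complex.I_sq
      fin_cases k <;> simp [complexSubst, complexCoords] <;> grind
    simp [hq, h]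

open MvPolynomial in
/-- In the coordinates `u, ū, v, v̄` the Laplacian is `4 (∂_u ∂_ū + ∂_v ∂_v̄)`. -/
theorem wirtinger_laplacian (P : MvPolynomial (Fin 4) ℝ) :
    4 * (pderiv 0 (pderiv 1 (aeval complexSubst P)) + pderiv 2 (pderiv 3 (aeval complexSubst P))) =
      aeval complexSubst (∑ i, pderiv i (pderiv i P)) := by
  have hI : 4 * (C (Complex.I / 2) : MvPolynomial (Fin 4) ℂ) ^ 2 = -1 := by
    rw [← map_ofNat C 4, ← C_pow, ← C_mul, div_pow, Complex.I_sq]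
    norm_num
  have hneg : (C (-Complex.I / 2) : MvPolynomial (Fin 4) ℂ) = -C (Complex.I / 2) := by
    rw [neg_div, C_neg]
  have h2 : 4 * (C (1 / 2) : MvPolynomial (Fin 4) ℂ) ^ 2 = 1 := by
    rw [← map_ofNat C 4, ← C_pow, ← C_mul]
    norm_num
  have hd (i j : Fin 4) : pderiv i (complexSubst j) =
      C (!![1 / 2, -Complex.I / 2, 0, 0; 1 / 2, Complex.I / 2, 0, 0;
        0, 0, 1 / 2, -Complex.I / 2; 0, 0, 1 / 2, Complex.I / 2] i j) := by
    fin_cases i <;> fin_cases j <;>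
      simp [complexSubst, pderiv_X, neg_div]
  have h10 := congrArg (aeval complexSubst) (pderiv_comm P 1 0)
  have h32 := congrArg (aeval complexSubst) (pderiv_comm P 3 2)
  simp only [pderiv_aeval, hd, Derivation.leibniz, Fin.sum_univ_four, map_add, smul_eq_mul]
  simp only [Matrix.of_apply, Matrix.cons_val, pderiv_C, map_zero, mul_zero, add_zero, zero_add,
    h10, h32, hneg]
  linear_combination
    (aeval complexSubst (pderiv 0 (pderiv 0 P)) + aeval complexSubst (pderiv 2 (pderiv 2 P))) * h2
    - (aeval complexSubst (pderiv 1 (pderiv 1 P)) + aeval complexSubst (pderiv 3 (pderiv 3 P))) * hI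

open MvPolynomial in
theorem coeff_recurrence {Q : MvPolynomial (Fin 4) ℂ}
    (h : pderiv 0 (pderiv 1 Q) + pderiv 2 (pderiv 3 Q) = 0) (s : Fin 4 →₀ ℕ) :
    (s 0 + 1) * (s 1 + 1) * coeff (s + .single 0 1 + .single 1 1) Q +
      (s 2 + 1) * (s 3 + 1) * coeff (s + .single 2 1 + .single 3 1) Q = 0 := by
  have := congrArg (coeff s) h
  simp [coeff_pderiv] at this
  linear_combination this

/-- The exponent of the `i`-th monomial `u^a ū^b v^c v̄^e` with `a - b = ℓ` and `c - e = m`. -/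
def chainExp (ℓ m : ℤ) (d i : ℕ) : Fin 4 →₀ ℕ :=
  Finsupp.equivFunOnFinite.symm
    ![ℓ.toNat + i, (-ℓ).toNat + i, m.toNat + (d - i), (-m).toNat + (d - i)]

open MvPolynomial in
theorem coeff_chainExp_succ {Q : MvPolynomial (Fin 4) ℂ}
    (h : pderiv 0 (pderiv 1 Q) + pderiv 2 (pderiv 3 Q) = 0) (ℓ m : ℤ) (i j : ℕ) :
    ((i : ℂ) + 1) * (ℓ.natAbs + i + 1) * coeff (chainExp ℓ m (i + j + 1) (i + 1)) Q +
      (j + 1) * (m.natAbs + j + 1) * coeff (chainExp ℓ m (i + j + 1) i) Q = 0 := by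
  have key := coeff_recurrence h
    (Finsupp.equivFunOnFinite.symm ![ℓ.toNat + i, (-ℓ).toNat + i, m.toNat + j, (-m).toNat + j])
  have e1 : Finsupp.equivFunOnFinite.symm
      ![ℓ.toNat + i, (-ℓ).toNat + i, m.toNat + j, (-m).toNat + j] +
      .single 0 1 + .single 1 1 = chainExp ℓ m (i + j + 1) (i + 1) := by
    ext t
    fin_cases t <;> simp [chainExp, Finsupp.add_apply, -Finsupp.coe_add] <;> omega
  have e2 : Finsupp.equivFunOnFinite.symm
      ![ℓ.toNat + i, (-ℓ).toNat + i, m.toNat + j, (-m).toNat + j] +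
      .single 2 1 + .single 3 1 = chainExp ℓ m (i + j + 1) i := by
    ext t
    fin_cases t <;> simp [chainExp, Finsupp.add_apply, -Finsupp.coe_add] <;> omega
  rw [e1, e2] at key
  have hp (n : ℤ) (t : ℕ) : (((n.toNat + t : ℕ) : ℂ) + 1) * (((-n).toNat + t : ℕ) + 1) =
      (t + 1) * (n.natAbs + t + 1) := by
    norm_cast
    rcases le_total 0 n with hn | hn
    · rw [show (-n).toNat = 0 by omega, show n.toNat = n.natAbs by omega]; ring
    · rw [show n.toNat = 0 by omega, show (-n).toNat = n.natAbs by omega]; ring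
  simpa only [Finsupp.coe_equivFunOnFinite_symm, Matrix.cons_val, hp] using key

open MvPolynomial in
theorem choose_mul_coeff_chainExp {Q : MvPolynomial (Fin 4) ℂ}
    (h : pderiv 0 (pderiv 1 Q) + pderiv 2 (pderiv 3 Q) = 0) (ℓ m : ℤ) (d i : ℕ) (hi : i ≤ d) :
    ((ℓ.natAbs + d).choose d : ℂ) * coeff (chainExp ℓ m d i) Q =
      (-1) ^ i * coeff (chainExp ℓ m d 0) Q *
        ((m.natAbs + d).choose i * (ℓ.natAbs + d).choose (d - i)) := by
  induction i with
  | zero => simp [mul_comm]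
  | succ i ih =>
    obtain ⟨j, rfl⟩ : ∃ j, d = i + j + 1 := ⟨d - (i + 1), by omega⟩
    have ih := ih (by omega)
    have hrec := coeff_chainExp_succ h ℓ m i j
    have h1 := Nat.choose_succ_right_eq (m.natAbs + (i + j + 1)) i
    have h2 := Nat.choose_succ_right_eq (ℓ.natAbs + (i + j + 1)) j
    rw [show m.natAbs + (i + j + 1) - i = m.natAbs + j + 1 by omega] at h1
    rw [show ℓ.natAbs + (i + j + 1) - j = ℓ.natAbs + i + 1 by omega] at h2
    rw [show i + j + 1 - i = j + 1 by omega] at ih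
    rw [show i + j + 1 - (i + 1) = j by omega]
    replace h1 := congrArg (Nat.cast (R := ℂ)) h1
    replace h2 := congrArg (Nat.cast (R := ℂ)) h2
    push_cast at h1 h2
    have hne : ((i : ℂ) + 1) * (ℓ.natAbs + i + 1) ≠ 0 := by
      norm_cast
    apply mul_left_cancel₀ hne
    linear_combination ((ℓ.natAbs + (i + j + 1)).choose (i + j + 1) : ℂ) * hrec
      - (j + 1) * (m.natAbs + j + 1) * ih
      - (-1) ^ i * coeff (chainExp ℓ m (i + j + 1) 0) Q *
        ((m.natAbs + j + 1) * (m.natAbs + (i + j + 1)).choose i * h2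
          - (ℓ.natAbs + (i + j + 1)).choose j * (ℓ.natAbs + i + 1) * h1)

theorem circ_natCast (n : ℕ) (x y : ℝ) : circ n x y = (((x : ℂ) + y * Complex.I) ^ n).re := by
  simp [circ]

theorem circ_neg_natCast {n : ℕ} (hn : n ≠ 0) (x y : ℝ) :
    circ (-n) x y = (((x : ℂ) + y * Complex.I) ^ n).im := by
  simp [circ, hn]

/-- `u^ℓ` (read as `ū^(-ℓ)` if `ℓ < 0`) in terms of the real circular harmonics. -/
theorem exists_pow_mul_pow_eq_circ (ℓ : ℤ) : ∃ ε : ℝ, ∀ x y : ℝ,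
    ((x : ℂ) + y * Complex.I) ^ ℓ.toNat * ((x : ℂ) - y * Complex.I) ^ (-ℓ).toNat =
      circ ℓ.natAbs x y + ε * circ (-ℓ.natAbs) x y * Complex.I := by
  rcases lt_trichotomy ℓ 0 with h | rfl | h
  · refine ⟨-1, fun x y => ?_⟩
    have hc : (x : ℂ) - y * Complex.I = starRingEnd ℂ (x + y * Complex.I) := by
      simp [sub_eq_add_neg]
    rw [show ℓ.toNat = 0 by omega, show (-ℓ).toNat = ℓ.natAbs by omega, hc, ← map_pow]
    rw [circ_natCast, circ_neg_natCast (by omega)]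
    generalize ((x : ℂ) + y * Complex.I) ^ ℓ.natAbs = z
    apply Complex.ext <;> simp
  · exact ⟨0, fun x y => by simp [circ]⟩
  · refine ⟨1, fun x y => ?_⟩
    rw [show (-ℓ).toNat = 0 by omega, show ℓ.toNat = ℓ.natAbs by omega]
    rw [circ_natCast, circ_neg_natCast (by omega)]
    generalize ((x : ℂ) + y * Complex.I) ^ ℓ.natAbs = z
    apply Complex.ext <;> simp

/-- The complex-valued analogue of `F`, with `u^ℓ v^m` in place of the real circular harmonics. -/
def complexF (k : ℕ) (ℓ m : ℤ) (p : Fin 4 → ℝ) : ℂ :=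
  ((∑ i ∈ Finset.range (dd k ℓ m + 1),
      (Nat.choose (m.natAbs + dd k ℓ m) i : ℝ) *
      (Nat.choose (ℓ.natAbs + dd k ℓ m) (dd k ℓ m - i) : ℝ) *
      (p 0 ^ 2 + p 1 ^ 2) ^ i * (-(p 2 ^ 2 + p 3 ^ 2)) ^ (dd k ℓ m - i) : ℝ) : ℂ)
    * (((p 0 : ℂ) + p 1 * Complex.I) ^ ℓ.toNat * ((p 0 : ℂ) - p 1 * Complex.I) ^ (-ℓ).toNat)
    * (((p 2 : ℂ) + p 3 * Complex.I) ^ m.toNat * ((p 2 : ℂ) - p 3 * Complex.I) ^ (-m).toNat)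

theorem re_mul_complexF_mem_span (k : ℕ) (ℓ m : ℤ) (hk : ℓ.natAbs + m.natAbs ≤ k)
    (hp : Int.ModEq 2 (ℓ + m) k) (c : ℂ) :
    (fun p => (c * complexF k ℓ m p).re) ∈ Submodule.span ℝ
      {g : (Fin 4 → ℝ) → ℝ | ∃ ℓ m : ℤ,
        ℓ.natAbs + m.natAbs ≤ k ∧ Int.ModEq 2 (ℓ + m) k ∧ g = F k ℓ m} := by
  obtain ⟨ε, hε⟩ := exists_pow_mul_pow_eq_circ ℓ
  obtain ⟨δ, hδ⟩ := exists_pow_mul_pow_eq_circ m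
  have mem (ℓ' m' : ℤ) (hℓ : ℓ'.natAbs = ℓ.natAbs) (hm : m'.natAbs = m.natAbs) :
      F k ℓ' m' ∈ Submodule.span ℝ {g : (Fin 4 → ℝ) → ℝ | ∃ ℓ m : ℤ,
        ℓ.natAbs + m.natAbs ≤ k ∧ Int.ModEq 2 (ℓ + m) k ∧ g = F k ℓ m} := by
    refine Submodule.subset_span ⟨ℓ', m', by omega, ?_, rfl⟩
    unfold Int.ModEq at *
    omega
  have e : (fun p => (c * complexF k ℓ m p).re) =
      c.re • F k ℓ.natAbs m.natAbs - (c.re * ε * δ) • F k (-ℓ.natAbs) (-m.natAbs)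
        - (c.im * δ) • F k ℓ.natAbs (-m.natAbs) - (c.im * ε) • F k (-ℓ.natAbs) m.natAbs := by
    funext p
    rw [complexF, hε, hδ]
    simp [F, dd, -Nat.cast_natAbs, -Complex.ofReal_sum]
    ring
  rw [e]
  refine sub_mem (sub_mem (sub_mem ?_ ?_) ?_) ?_ <;>
    exact Submodule.smul_mem _ _ (mem _ _ (by omega) (by omega))

theorem chainExp_injective (ℓ m : ℤ) (d : ℕ) : Function.Injective (chainExp ℓ m d) := by
  intro i j hij
  simpa [chainExp] using DFunLike.congr_fun hij 0

theorem eq_chainExp {k : ℕ} {s : Fin 4 →₀ ℕ} (hs : s.degree = k) {ℓ m : ℤ}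
    (hℓ : (s 0 : ℤ) - s 1 = ℓ) (hm : (s 2 : ℤ) - s 3 = m) :
    ℓ.natAbs + m.natAbs ≤ k ∧ Int.ModEq 2 (ℓ + m) k ∧
      ∃ i ≤ dd k ℓ m, chainExp ℓ m (dd k ℓ m) i = s := by
  simp only [Finsupp.degree_eq_sum, Fin.sum_univ_four] at hs
  refine ⟨by omega, by unfold Int.ModEq; omega, min (s 0) (s 1), by unfold dd; omega, ?_⟩
  ext t
  fin_cases t <;> simp [chainExp, dd] <;> omega

open MvPolynomial in
/-- The part of weight `(ℓ, m)` of a harmonic polynomial is a multiple of `complexF`. -/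
theorem exists_sum_chainExp_eq {Q : MvPolynomial (Fin 4) ℂ}
    (h : pderiv 0 (pderiv 1 Q) + pderiv 2 (pderiv 3 Q) = 0) (k : ℕ) (ℓ m : ℤ) :
    ∃ c : ℂ, ∀ p, ∑ i ∈ Finset.range (dd k ℓ m + 1), coeff (chainExp ℓ m (dd k ℓ m) i) Q *
      ∏ t, complexCoords p t ^ chainExp ℓ m (dd k ℓ m) i t = c * complexF k ℓ m p := by
  set d := dd k ℓ m with hd
  have hne : ((ℓ.natAbs + d).choose d : ℂ) ≠ 0 := by
    exact_mod_cast (Nat.choose_pos (by omega)).ne'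
  refine ⟨(-1) ^ d * coeff (chainExp ℓ m d 0) Q / (ℓ.natAbs + d).choose d, fun p => ?_⟩
  rw [complexF, ← hd]
  simp only [Complex.ofReal_sum, Finset.sum_mul, Finset.mul_sum]
  refine Finset.sum_congr rfl fun i hi => ?_
  have hi : i ≤ d := by simpa [Nat.lt_succ_iff] using hi
  have hc := choose_mul_coeff_chainExp h ℓ m d i hi
  have hs : ((-1 : ℂ)) ^ i = (-1) ^ d * (-1) ^ (d - i) := by
    rw [← pow_add, show d + (d - i) = i + 2 * (d - i) by omega, pow_add, pow_mul]; simp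
  have hn (x y : ℝ) : ((x ^ 2 + y ^ 2 : ℝ) : ℂ) = (x + y * Complex.I) * (x - y * Complex.I) := by
    have := Complex.I_sq
    push_cast; linear_combination (y : ℂ) ^ 2 * this
  rw [eq_div_of_mul_eq hne ((mul_comm _ _).trans hc), hs]
  have hpow := neg_pow (((p 2 : ℂ) + p 3 * Complex.I) * (p 2 - p 3 * Complex.I)) (d - i)
  rw [Fin.prod_univ_four]
  simp only [Complex.ofReal_mul, Complex.ofReal_pow, Complex.ofReal_neg, hn, hpow, Complex.ofReal_natCast]
  simp only [chainExp, complexCoords, Finsupp.coe_equivFunOnFinite_symm,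
    Matrix.cons_val, pow_add, mul_pow]
  ring

open MvPolynomial in
theorem exists_eval_eq_sum_complexF {k : ℕ} {Q : MvPolynomial (Fin 4) ℂ} (hQ : Q.IsHomogeneous k)
    (h : pderiv 0 (pderiv 1 Q) + pderiv 2 (pderiv 3 Q) = 0) :
    ∃ (T : Finset (ℤ × ℤ)) (c : ℤ × ℤ → ℂ),
      (∀ a ∈ T, a.1.natAbs + a.2.natAbs ≤ k ∧ Int.ModEq 2 (a.1 + a.2) k) ∧
      ∀ p, eval (complexCoords p) Q = ∑ a ∈ T, c a * complexF k a.1 a.2 p := by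
  classical
  choose c hc using fun a : ℤ × ℤ => exists_sum_chainExp_eq h k a.1 a.2
  let wt (s : Fin 4 →₀ ℕ) : ℤ × ℤ := ((s 0 : ℤ) - s 1, (s 2 : ℤ) - s 3)
  have hdeg {s : Fin 4 →₀ ℕ} (hs : s ∈ Q.support) : s.degree = k := by
    rw [Finsupp.degree_eq_weight_one]; exact hQ (mem_support_iff.1 hs)
  refine ⟨Q.support.image wt, c, ?_, fun p => ?_⟩
  · simp only [Finset.mem_image, forall_exists_index, and_imp]
    rintro _ s hs rfl
    have := eq_chainExp (hdeg hs) rfl rfl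
    exact ⟨this.1, this.2.1⟩
  · rw [eval_eq', ← Finset.sum_fiberwise_of_maps_to (t := Q.support.image wt) (g := wt)
      fun s hs => Finset.mem_image_of_mem _ hs]
    refine Finset.sum_congr rfl fun a _ => ?_
    rw [← hc a p, ← Finset.sum_image (s := Finset.range (dd k a.1 a.2 + 1))
      (f := fun s => coeff s Q * ∏ t, complexCoords p t ^ s t)
      (chainExp_injective a.1 a.2 (dd k a.1 a.2)).injOn]
    refine Finset.sum_subset (fun s hs => ?_) fun s hs hsf => ?_
    · obtain ⟨hsQ, rfl⟩ := Finset.mem_filter.1 hs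
      obtain ⟨-, -, i, hi, e⟩ := eq_chainExp (hdeg hsQ) rfl rfl
      exact Finset.mem_image.2 ⟨i, by simpa [Nat.lt_succ_iff] using hi, e⟩
    · obtain ⟨i, -, rfl⟩ := Finset.mem_image.1 hs
      have hwt : wt (chainExp a.1 a.2 (dd k a.1 a.2) i) = a := by
        ext <;> simp [wt, chainExp]
      simp only [Finset.mem_filter, hwt, and_true, notMem_support_iff] at hsf
      simp [hsf]

/-- every homogeneous harmonic polynomial function of degree `k`
is a real linear combination of the `F_{kℓm}`. -/
theorem stmt_7 (k : ℕ) (f : (Fin 4 → ℝ) → ℝ)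
    (hf : IsHomogeneousPolyEval k f) (hh : IsHarmonic f) :
    f ∈ Submodule.span ℝ
      {g : (Fin 4 → ℝ) → ℝ | ∃ ℓ m : ℤ,
        ℓ.natAbs + m.natAbs ≤ k ∧ Int.ModEq 2 (ℓ + m) k ∧ g = F k ℓ m} := by
  obtain ⟨P, hP, hPf⟩ := hf
  obtain rfl : (fun v => MvPolynomial.eval v P) = f := funext hPf
  have hlap := wirtinger_laplacian P
  rw [sum_pderiv_pderiv_eq_zero hh, map_zero] at hlap
  have hQ : (MvPolynomial.aeval complexSubst P).IsHomogeneous k := by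
    simpa using hP.aeval complexSubst isHomogeneous_complexSubst
  obtain ⟨T, c, hT, hsum⟩ := exists_eval_eq_sum_complexF hQ
    ((mul_eq_zero.1 hlap).resolve_left (by norm_num))
  have e : (fun v => MvPolynomial.eval v P) =
      ∑ a ∈ T, fun p => (c a * complexF k a.1 a.2 p).re := by
    funext p
    rw [Finset.sum_apply, ← Complex.re_sum, ← hsum, eval_aeval_complexSubst, Complex.ofReal_re]
  rw [e]
  exact sum_mem fun a ha => re_mul_complexF_mem_span k a.1 a.2 (hT a ha).1 (hT a ha).2 (c a)

end
end
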